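/- Let V : ℤ → ℝ be a bounded potential having γ-repetitions along a sequence k_n → +∞ (i.e., |V(k_n + k) − V(k)| ≤ e^{−γ k_n} for all k ∈ ℤ and all n), and let E ∈ ℂ with 𝓛(E) < ∞. Then for every ε > 0 there is a constant C > 0 (depending on ε, E, and V) such that for all m, j ∈ ℤ and all n, ‖A_{m,j}(E) − A_{m+k_n, j+k_n}(E)‖ ≤ C e^{−γ k_n} e^{(𝓛(E)+ε)|m−j|}. -/

import Mathlib

open Filter Matrix

noncomputable section

attribute [local instance] Matrix.linftyOpNormedRing

/-- One-step transfer matrix `A_k(E)`. -/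
def oneStep (V : ℤ → ℝ) (E : ℂ) (k : ℤ) : Matrix (Fin 2) (Fin 2) ℂ :=
  !![E - (V k : ℂ), -1; 1, 0]

/-- For `j ≤ k`, the product `A_{k-1}(E) A_{k-2}(E) ⋯ A_j(E)`. -/
def transferFwd (V : ℤ → ℝ) (E : ℂ) (k j : ℤ) : Matrix (Fin 2) (Fin 2) ℂ :=
  (((List.range (k - j).toNat).map fun i => oneStep V E (k - 1 - i)).prod)

/-- Multi-step transfer matrix `A_{k,j}(E)`. -/
def transfer (V : ℤ → ℝ) (E : ℂ) (k j : ℤ) : Matrix (Fin 2) (Fin 2) ℂ :=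
  if j ≤ k then transferFwd V E k j else (transferFwd V E j k)⁻¹

/-- `𝓛(E) = limsup_{k→∞} sup_{j∈ℤ} ln‖A_{k+j,j}(E)‖ / k`, as an extended real number. -/
def transferExp (V : ℤ → ℝ) (E : ℂ) : EReal :=
  Filter.limsup
    (fun k : ℕ => ⨆ j : ℤ, ((Real.log ‖transfer V E ((k : ℤ) + j) j‖ / (k : ℝ) : ℝ) : EReal))
    Filter.atTop

/-- `β(α) = limsup_{k→∞} (-ln ‖kα‖_𝕋)/k`, where `‖x‖_𝕋 = dist(x, ℤ)`. -/
def beta (α : ℝ) : EReal :=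
  Filter.limsup
    (fun k : ℕ => (((-Real.log |(k : ℝ) * α - round ((k : ℝ) * α)|) / (k : ℝ) : ℝ) : EReal))
    Filter.atTop


theorem transferFwd_add_natCast (V : ℤ → ℝ) (E : ℂ) (j : ℤ) (k : ℕ) :
    transferFwd V E (j + k) j =
      ((List.range k).map fun i : ℕ => oneStep V E (j + k - 1 - i)).prod := by
  have h : (j + (k : ℤ) - j).toNat = k := by omega
  rw [transferFwd, h]
  simp only [List.pure_def, List.bind_eq_flatMap, ← List.map_eq_flatMap, List.map_map]
  rfl

theorem transferFwd_succ_left (V : ℤ → ℝ) (E : ℂ) (j : ℤ) (k : ℕ) :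
    transferFwd V E (j + (k + 1 : ℕ)) j = oneStep V E (j + k) * transferFwd V E (j + k) j := by
  rw [transferFwd_add_natCast, transferFwd_add_natCast, List.range_succ_eq_map, List.map_cons, List.prod_cons,
    List.map_map]
  congr 3
  · push_cast; ring
  · funext i
    simp only [Function.comp_apply]
    congr 1
    push_cast
    ring

theorem transferFwd_succ_right (V : ℤ → ℝ) (E : ℂ) (j : ℤ) (k : ℕ) :
    transferFwd V E (j + (k + 1 : ℕ)) j =
      transferFwd V E (j + 1 + k) (j + 1) * oneStep V E j := by
  have h3 : j + ((k + 1 : ℕ) : ℤ) = j + 1 + k := by push_cast; ring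
  rw [transferFwd_add_natCast, transferFwd_add_natCast, h3, List.range_succ, List.map_append, List.prod_append]
  simp only [List.map_cons, List.map_nil, List.prod_singleton]
  congr 2
  ring

theorem transferFwd_self (V : ℤ → ℝ) (E : ℂ) (j : ℤ) : transferFwd V E (j + (0 : ℕ)) j = 1 := by
  simp [transferFwd]

theorem det_transferFwd (V : ℤ → ℝ) (E : ℂ) (k j : ℤ) : (transferFwd V E k j).det = 1 := by
  rw [transferFwd, ← Matrix.coe_detMonoidHom, map_list_prod, List.map_map]
  apply List.prod_eq_one
  simp [oneStep, Matrix.det_fin_two]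

theorem transfer_add_natCast (V : ℤ → ℝ) (E : ℂ) (j : ℤ) (k : ℕ) :
    transfer V E (j + k) j = transferFwd V E (j + k) j :=
  if_pos (by omega)

theorem norm_row_le (A : Matrix (Fin 2) (Fin 2) ℂ) (i : Fin 2) : ‖A i 0‖ + ‖A i 1‖ ≤ ‖A‖ := by
  rw [Matrix.linfty_opNorm_def]
  have h := Finset.le_sup (f := fun i => ∑ j, ‖A i j‖₊) (Finset.mem_univ i)
  simpa [Fin.sum_univ_two] using NNReal.coe_le_coe.2 h

theorem norm_le_of_row_le {A : Matrix (Fin 2) (Fin 2) ℂ} {r : ℝ}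
    (h : ∀ i, ‖A i 0‖ + ‖A i 1‖ ≤ r) : ‖A‖ ≤ r := by
  have hr : 0 ≤ r := (by positivity : 0 ≤ ‖A 0 0‖ + ‖A 0 1‖).trans (h 0)
  lift r to NNReal using hr
  rw [Matrix.linfty_opNorm_def, NNReal.coe_le_coe]
  refine Finset.sup_le fun i _ => ?_
  rw [← NNReal.coe_le_coe]
  simpa [Fin.sum_univ_two] using h i

theorem norm_inv_sub_inv_le {A B : Matrix (Fin 2) (Fin 2) ℂ} (hA : A.det = 1) (hB : B.det = 1) :
    ‖A⁻¹ - B⁻¹‖ ≤ 2 * ‖A - B‖ := by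
  have h0 := norm_row_le (A - B) 0
  have h1 := norm_row_le (A - B) 1
  simp only [Matrix.sub_apply] at h0 h1
  rw [Matrix.inv_def, Matrix.inv_def, hA, hB, Matrix.adjugate_fin_two, Matrix.adjugate_fin_two]
  have n00 := norm_nonneg (A 0 0 - B 0 0)
  have n01 := norm_nonneg (A 0 1 - B 0 1)
  have n10 := norm_nonneg (A 1 0 - B 1 0)
  have n11 := norm_nonneg (A 1 1 - B 1 1)
  refine norm_le_of_row_le fun i => ?_
  fin_cases i
  · simp [neg_add_eq_sub, norm_sub_rev (B 0 1)]
    linarith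
  · simp [neg_add_eq_sub, norm_sub_rev (B 1 0)]
    linarith

theorem norm_oneStep_le {V : ℤ → ℝ} {M : ℝ} (hV : ∀ k, |V k| ≤ M) (E : ℂ) (k : ℤ) :
    ‖oneStep V E k‖ ≤ ‖E‖ + M + 1 := by
  have hM : 0 ≤ M := (abs_nonneg _).trans (hV k)
  refine norm_le_of_row_le fun i => ?_
  fin_cases i
  · have h : ‖E - (V k : ℂ)‖ ≤ ‖E‖ + |V k| := by
      simpa using norm_sub_le E (V k : ℂ)
    simp [oneStep]
    linarith [hV k]
  · simp [oneStep]
    positivity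

theorem norm_oneStep_sub (V : ℤ → ℝ) (E : ℂ) (i k : ℤ) :
    ‖oneStep V E i - oneStep V E k‖ ≤ |V k - V i| := by
  refine norm_le_of_row_le fun l => ?_
  fin_cases l
  · simp [oneStep]
    rw [← Complex.ofReal_sub, Complex.norm_real, Real.norm_eq_abs]
  · simp [oneStep]

theorem norm_transferFwd_le_pow {V : ℤ → ℝ} {E : ℂ} {D : ℝ} (hD : ∀ k, ‖oneStep V E k‖ ≤ D)
    (j : ℤ) (k : ℕ) :
    ‖transferFwd V E (j + k) j‖ ≤ ‖(1 : Matrix (Fin 2) (Fin 2) ℂ)‖ * D ^ k := by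
  induction k with
  | zero => rw [transferFwd_self]; simp
  | succ k ih =>
    rw [transferFwd_succ_left]
    calc _ ≤ ‖oneStep V E (j + k)‖ * ‖transferFwd V E (j + k) j‖ := norm_mul_le _ _
      _ ≤ D * (‖(1 : Matrix (Fin 2) (Fin 2) ℂ)‖ * D ^ k) :=
        mul_le_mul (hD _) ih (norm_nonneg _) ((norm_nonneg _).trans (hD 0))
      _ = _ := by ring

/-- Any real number above `𝓛(E)` is a uniform exponential growth rate of the transfer matrices. -/
theorem exists_norm_transferFwd_le {V : ℤ → ℝ} (hV : ∃ M : ℝ, ∀ k : ℤ, |V k| ≤ M) {E : ℂ} {b : ℝ}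
    (hb : transferExp V E < b) :
    ∃ C > (0 : ℝ), ∀ (j : ℤ) (k : ℕ), ‖transferFwd V E (j + k) j‖ ≤ C * Real.exp (b * k) := by
  obtain ⟨M, hM⟩ := hV
  have hM0 : 0 ≤ M := (abs_nonneg _).trans (hM 0)
  set D := ‖E‖ + M + 1
  have hD1 : 1 ≤ D := by simp only [D]; linarith [norm_nonneg E]
  obtain ⟨N, hN⟩ := eventually_atTop.1 (eventually_lt_of_limsup_lt hb)
  set c := ‖(1 : Matrix (Fin 2) (Fin 2) ℂ)‖ * D ^ N * Real.exp (|b| * N)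
  have hc : 0 ≤ c := by positivity
  refine ⟨c + 1, by linarith, fun j k => ?_⟩
  have hexp := Real.exp_pos (b * k)
  by_cases hk : N ≤ k ∧ 0 < k
  · have hk0 : (0 : ℝ) < k := by exact_mod_cast hk.2
    have h := (le_iSup (fun j : ℤ => ((Real.log ‖transfer V E ((k : ℤ) + j) j‖ / (k : ℝ) : ℝ) :
      EReal)) j).trans (hN k hk.1).le
    rw [EReal.coe_le_coe_iff, div_le_iff₀ hk0, add_comm (k : ℤ), transfer_add_natCast] at h
    calc _ ≤ Real.exp (Real.log ‖transferFwd V E (j + k) j‖) := Real.le_exp_log _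
      _ ≤ 1 * Real.exp (b * k) := by rw [one_mul]; exact Real.exp_le_exp.2 h
      _ ≤ _ := by gcongr; linarith
  · have hkN : k ≤ N := by omega
    have hkN' : (k : ℝ) ≤ N := by exact_mod_cast hkN
    have h1 : 1 ≤ Real.exp (|b| * N) * Real.exp (b * k) := by
      rw [← Real.exp_add]
      apply Real.one_le_exp
      have h2 : -|b| * k ≤ b * k := by gcongr; exact neg_abs_le b
      have h3 : |b| * k ≤ |b| * N := by gcongr
      linarith
    calc _ ≤ ‖(1 : Matrix (Fin 2) (Fin 2) ℂ)‖ * D ^ k :=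
          norm_transferFwd_le_pow (norm_oneStep_le hM E) j k
      _ ≤ ‖(1 : Matrix (Fin 2) (Fin 2) ℂ)‖ * D ^ N * 1 := by rw [mul_one]; gcongr
      _ ≤ ‖(1 : Matrix (Fin 2) (Fin 2) ℂ)‖ * D ^ N *
          (Real.exp (|b| * N) * Real.exp (b * k)) := by gcongr
      _ = c * Real.exp (b * k) := by simp only [c]; ring
      _ ≤ _ := by gcongr; linarith

/-- Telescoping estimate for the difference of a transfer matrix and its translate, multiplied on
the left by a further transfer matrix so that the induction on the length goes through. -/
theorem norm_transferFwd_mul_sub_le {V : ℤ → ℝ} {E : ℂ} {b C δ : ℝ} {s : ℤ}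
    (hC : ∀ (j : ℤ) (k : ℕ), ‖transferFwd V E (j + k) j‖ ≤ C * Real.exp (b * k))
    (hs : ∀ k, |V (s + k) - V k| ≤ δ) (j : ℤ) (k l : ℕ) :
    ‖transferFwd V E (j + k + l) (j + k) *
        (transferFwd V E (j + k) j - transferFwd V E (j + s + k) (j + s))‖ ≤
      k * (C ^ 2 * δ * Real.exp (-b)) * Real.exp (b * (l + k)) := by
  induction k generalizing l with
  | zero => rw [transferFwd_self, transferFwd_self]; simp
  | succ k ih =>
    have e : j + ((k + 1 : ℕ) : ℤ) = j + k + 1 := by push_cast; ring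
    have hr := transferFwd_succ_right V E (j + k) l
    set P := transferFwd V E (j + k + 1 + l) (j + k + 1) with hP
    have key : transferFwd V E (j + (k + 1 : ℕ) + l) (j + (k + 1 : ℕ)) *
        (transferFwd V E (j + (k + 1 : ℕ)) j -
          transferFwd V E (j + s + (k + 1 : ℕ)) (j + s)) =
        transferFwd V E (j + k + (l + 1 : ℕ)) (j + k) *
          (transferFwd V E (j + k) j - transferFwd V E (j + s + k) (j + s)) +
        P * (oneStep V E (j + k) - oneStep V E (j + s + k)) *
          transferFwd V E (j + s + k) (j + s) := by
      rw [transferFwd_succ_left, transferFwd_succ_left, hr, e, ← hP]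
      noncomm_ring
    rw [key]
    have hδ : 0 ≤ δ := (abs_nonneg _).trans (hs 0)
    have hd : ‖oneStep V E (j + k) - oneStep V E (j + s + k)‖ ≤ δ := by
      refine (norm_oneStep_sub V E _ _).trans ?_
      rw [show j + s + (k : ℤ) = s + (j + k) by ring]
      exact hs _
    have h2 : ‖P * (oneStep V E (j + k) - oneStep V E (j + s + k)) *
        transferFwd V E (j + s + k) (j + s)‖ ≤
        C * Real.exp (b * l) * δ * (C * Real.exp (b * k)) := by
      have hP' : ‖P‖ ≤ C * Real.exp (b * l) := hC _ _
      have hnn := (norm_nonneg _).trans hP'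
      refine (norm_mul_le _ _).trans (mul_le_mul ((norm_mul_le _ _).trans
        (mul_le_mul hP' hd (norm_nonneg _) hnn)) (hC _ _) (norm_nonneg _) (by positivity))
    have h1 := ih (l + 1)
    have e1 : Real.exp (b * (((l + 1 : ℕ) : ℝ) + k)) = Real.exp (b * (l + (k + 1 : ℕ))) := by
      push_cast; ring_nf
    have e2 : Real.exp (b * l) * Real.exp (b * k) =
        Real.exp (-b) * Real.exp (b * (l + (k + 1 : ℕ))) := by
      rw [← Real.exp_add, ← Real.exp_add]
      push_cast
      ring_nf
    rw [e1] at h1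
    refine (norm_add_le _ _).trans ((add_le_add h1 h2).trans (le_of_eq ?_))
    calc _ = k * (C ^ 2 * δ * Real.exp (-b)) * Real.exp (b * (l + (k + 1 : ℕ))) +
          C ^ 2 * δ * (Real.exp (b * l) * Real.exp (b * k)) := by ring
      _ = _ := by rw [e2]; push_cast; ring

theorem norm_transferFwd_sub_le {V : ℤ → ℝ} {E : ℂ} {b C δ ε : ℝ} {s : ℤ} (hε : 0 < ε)
    (hC : ∀ (j : ℤ) (k : ℕ), ‖transferFwd V E (j + k) j‖ ≤ C * Real.exp (b * k))
    (hs : ∀ k, |V (s + k) - V k| ≤ δ) (j : ℤ) (k : ℕ) :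
    ‖transferFwd V E (j + k) j - transferFwd V E (j + s + k) (j + s)‖ ≤
      C ^ 2 * Real.exp (-b) / ε * δ * Real.exp ((b + ε) * k) := by
  have hδ : 0 ≤ δ := (abs_nonneg _).trans (hs 0)
  have h := norm_transferFwd_mul_sub_le hC hs j k 0
  rw [transferFwd_self, one_mul, Nat.cast_zero, zero_add] at h
  have hk : (k : ℝ) ≤ Real.exp (ε * k) / ε := by
    rw [le_div_iff₀ hε]
    linarith [Real.add_one_le_exp (ε * k)]
  calc _ ≤ k * (C ^ 2 * δ * Real.exp (-b)) * Real.exp (b * k) := h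
    _ ≤ Real.exp (ε * k) / ε * (C ^ 2 * δ * Real.exp (-b)) * Real.exp (b * k) := by gcongr
    _ = _ := by rw [add_mul, Real.exp_add]; ring

/-- Lemma 2.1: for a potential with `γ`-repetitions along `k_n → +∞` and `𝓛(E) < ∞`,
for every `ε > 0` there is `C > 0` such that for all `m, j ∈ ℤ` and all `n`,
`‖A_{m,j}(E) − A_{m+k_n,j+k_n}(E)‖ ≤ C e^{−γ k_n} e^{(𝓛(E)+ε)|m−j|}`. -/
theorem transfer_shift_close
    (V : ℤ → ℝ) (hV : ∃ M : ℝ, ∀ k : ℤ, |V k| ≤ M)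
    (γ : ℝ) (hγ : 0 < γ)
    (kseq : ℕ → ℤ) (hk : Tendsto kseq atTop atTop)
    (hrep : ∀ (n : ℕ) (k : ℤ),
      |V (kseq n + k) - V k| ≤ Real.exp (-γ * (kseq n : ℝ)))
    (E : ℂ) (hE : transferExp V E < ⊤) :
    ∀ ε > (0 : ℝ), ∃ C > (0 : ℝ), ∀ (m j : ℤ) (n : ℕ),
      ‖transfer V E m j - transfer V E (m + kseq n) (j + kseq n)‖ ≤
        C * Real.exp (-γ * (kseq n : ℝ)) *
          Real.exp (((transferExp V E).toReal + ε) * |(m : ℝ) - (j : ℝ)|) := by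
  intro ε hε
  set b := (transferExp V E).toReal + ε / 2 with hb
  have hlt : transferExp V E < (b : EReal) :=
    (EReal.le_coe_toReal hE.ne).trans_lt (EReal.coe_lt_coe_iff.2 (by linarith))
  obtain ⟨C, hC0, hC⟩ := exists_norm_transferFwd_le hV hlt
  have hbε : (transferExp V E).toReal + ε = b + ε / 2 := by rw [hb]; ring
  rw [hbε]
  set K := C ^ 2 * Real.exp (-b) / (ε / 2)
  have hK : 0 < K := by positivity
  have hsub : ∀ (j : ℤ) (k n : ℕ),
      ‖transferFwd V E (j + k) j - transferFwd V E (j + kseq n + k) (j + kseq n)‖ ≤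
        K * Real.exp (-γ * (kseq n : ℝ)) * Real.exp ((b + ε / 2) * k) :=
    fun j k n => norm_transferFwd_sub_le (half_pos hε) hC (hrep n) j k
  refine ⟨2 * K, by positivity, fun m j n => ?_⟩
  rcases le_total j m with h | h
  · obtain ⟨k, rfl⟩ := Int.le.dest h
    have habs : |((j + k : ℤ) : ℝ) - j| = k := by push_cast; simp
    rw [habs, add_right_comm, transfer_add_natCast, transfer_add_natCast]
    refine (hsub j k n).trans ?_
    gcongr
    linarith
  · obtain ⟨k, rfl⟩ := Int.le.dest h
    have habs : |(m : ℝ) - ((m + k : ℤ) : ℝ)| = k := by push_cast; simp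
    have hinv : ∀ i : ℤ, transfer V E i (i + k) = (transferFwd V E (i + k) i)⁻¹ := by
      intro i
      rcases Nat.eq_zero_or_pos k with rfl | hk0
      · simp [transfer, transferFwd]
      · exact if_neg (by omega)
    rw [habs, add_right_comm, hinv, hinv]
    refine (norm_inv_sub_inv_le (det_transferFwd ..) (det_transferFwd ..)).trans ?_
    linarith [hsub m k n]
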